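/- Let k be a field and Φ the 5×4 matrix over k[x_1,x_2,x_3] with rows [x_1,0,0,0], [x_2,x_1,0,0], [x_3,x_2,x_1,0], [0,x_3,x_2,x_1], [0,0,x_3,x_2]. Then x_1^4 and x_2^4 − 3x_1x_2^2x_3 + x_1^2x_3^2 belong to the ideal I_4(Φ) generated by the 4×4 minors of Φ; moreover ht(I_4(Φ)) ≥ 2 and ht(I_3(Φ)) = 3, where I_3(Φ) is the ideal of 3×3 minors of Φ. -/

import Mathlib

open MvPolynomial

set_option synthInstance.maxHeartbeats 1000000
set_option maxHeartbeats 1000000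

noncomputable section

/-- The graded polynomial ring `R = k[x₁,…,xₙ]`. -/
abbrev PolyR (k : Type) [Field k] (n : ℕ) : Type := MvPolynomial (Fin n) k

/-- The ideal of `t × t` minors of a matrix. -/
def minorsIdeal {R : Type} [CommRing R] {a b : ℕ} (t : ℕ) (φ : Matrix (Fin a) (Fin b) R) :
    Ideal R :=
  Ideal.span { d : R | ∃ (r : Fin t ↪ Fin a) (c : Fin t ↪ Fin b),
    d = (φ.submatrix r c).det }

/-- The height of an ideal. -/
def idealHeight {R : Type} [CommRing R] (I : Ideal R) : ℕ∞ :=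
  ⨅ (P : PrimeSpectrum R) (_ : I ≤ P.asIdeal), Order.height P

/-- The matrix `Φ` of the example, over `k[x₁,x₂,x₃]`. -/
def exMatrix (k : Type) [Field k] : Matrix (Fin 5) (Fin 4) (PolyR k 3) :=
  !![X 0, 0, 0, 0;
     X 1, X 0, 0, 0;
     X 2, X 1, X 0, 0;
     0, X 2, X 1, X 0;
     0, 0, X 2, X 1]

/-- A prime containing `s.card` many variables has height at least `s.card`. -/
theorem card_le_height_of_X_mem {k σ : Type} [Field k] [DecidableEq σ] (s : Finset σ)
    (P : PrimeSpectrum (MvPolynomial σ k)) (hP : ∀ i ∈ s, X i ∈ P.asIdeal) :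
    (s.card : ℕ∞) ≤ Order.height P := by
  induction s using Finset.induction_on generalizing P with
  | empty => simp
  | insert a s ha ih =>
    let f : MvPolynomial σ k →ₐ[k] MvPolynomial σ k := aeval fun i => if i ∈ s then 0 else X i
    let Q : PrimeSpectrum (MvPolynomial σ k) := ⟨RingHom.ker f, RingHom.ker_isPrime f⟩
    have hQ : ∀ i ∈ s, X i ∈ Q.asIdeal := fun i hi => by simp [Q, f, RingHom.mem_ker, hi]
    have haQ : X a ∉ Q.asIdeal := by simp [Q, f, RingHom.mem_ker, ha]
    have hcomp : (Ideal.Quotient.mkₐ k P.asIdeal).comp f = Ideal.Quotient.mkₐ k P.asIdeal := by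
      ext i
      by_cases hi : i ∈ s
      · simpa [f, hi] using
          (Ideal.Quotient.eq_zero_iff_mem.mpr (hP i (Finset.mem_insert_of_mem hi))).symm
      · simp [f, hi]
    have hle : Q.asIdeal ≤ P.asIdeal := fun p hp => by
      have hfp : f p = 0 := hp
      have := DFunLike.congr_fun hcomp p
      rw [AlgHom.comp_apply, hfp, map_zero] at this
      exact Ideal.Quotient.eq_zero_iff_mem.mp this.symm
    have hlt : Q < P := lt_of_le_of_ne hle fun h =>
      haQ (h ▸ hP a (Finset.mem_insert_self a s))
    rw [Finset.card_insert_of_notMem ha]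
    push_cast
    exact (add_le_add_left (ih Q hQ) 1).trans (Order.height_add_one_le hlt)

theorem minor_mem_minorsIdeal {R : Type} [CommRing R] {a b t : ℕ}
    (φ : Matrix (Fin a) (Fin b) R) (r : Fin t ↪ Fin a) (c : Fin t ↪ Fin b) :
    (φ.submatrix r c).det ∈ minorsIdeal t φ :=
  Ideal.subset_span ⟨r, c, rfl⟩

theorem X_zero_pow_mem_minorsIdeal_four (k : Type) [Field k] :
    (X 0 ^ 4 : PolyR k 3) ∈ minorsIdeal 4 (exMatrix k) := by
  have hsub : (exMatrix k).submatrix ![0, 1, 2, 3] ![0, 1, 2, 3] =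
      !![X 0, 0, 0, 0; X 1, X 0, 0, 0; X 2, X 1, X 0, 0; 0, X 2, X 1, X 0] := by
    ext1 i j
    fin_cases i <;> fin_cases j <;> rfl
  convert minor_mem_minorsIdeal (exMatrix k) ⟨![0, 1, 2, 3], by decide⟩ ⟨![0, 1, 2, 3], by decide⟩
    using 1
  rw [Function.Embedding.coeFn_mk, Function.Embedding.coeFn_mk, hsub]
  simp [Matrix.det_succ_row_zero, Fin.sum_univ_succ, Fin.succAbove]
  ring

theorem tridiagonal_minor_mem_minorsIdeal_four (k : Type) [Field k] :
    (X 1 ^ 4 - 3 * X 0 * X 1 ^ 2 * X 2 + X 0 ^ 2 * X 2 ^ 2 : PolyR k 3) ∈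
      minorsIdeal 4 (exMatrix k) := by
  have hsub : (exMatrix k).submatrix ![1, 2, 3, 4] ![0, 1, 2, 3] =
      !![X 1, X 0, 0, 0; X 2, X 1, X 0, 0; 0, X 2, X 1, X 0; 0, 0, X 2, X 1] := by
    ext1 i j
    fin_cases i <;> fin_cases j <;> rfl
  convert minor_mem_minorsIdeal (exMatrix k) ⟨![1, 2, 3, 4], by decide⟩ ⟨![0, 1, 2, 3], by decide⟩
    using 1
  rw [Function.Embedding.coeFn_mk, Function.Embedding.coeFn_mk, hsub]
  simp [Matrix.det_succ_row_zero, Fin.sum_univ_succ, Fin.succAbove]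
  ring

theorem X_mem_of_minorsIdeal_three_le {k : Type} [Field k] {P : Ideal (PolyR k 3)} [P.IsPrime]
    (hP : minorsIdeal 3 (exMatrix k) ≤ P) (i : Fin 3) : X i ∈ P := by
  have key (r : Fin 3 ↪ Fin 5) := hP (minor_mem_minorsIdeal (exMatrix k) r
    ⟨![0, 1, 2], by decide⟩)
  have m0 := key ⟨![0, 1, 2], by decide⟩
  have m1 := key ⟨![1, 2, 3], by decide⟩
  have m2 := key ⟨![2, 3, 4], by decide⟩
  rw [Matrix.det_fin_three] at m0 m1 m2
  simp only [← Ideal.Quotient.eq_zero_iff_mem] at m0 m1 m2 ⊢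
  have h0 : Ideal.Quotient.mk P (X 0) = 0 := by
    simpa [exMatrix] using m0
  have h1 : Ideal.Quotient.mk P (X 1) = 0 := by
    simpa [exMatrix, h0] using m1
  have h2 : Ideal.Quotient.mk P (X 2) = 0 := by
    simpa [exMatrix, h0, h1] using m2
  fin_cases i
  exacts [h0, h1, h2]

theorem idealHeight_minorsIdeal_three_le (k : Type) [Field k] :
    idealHeight (minorsIdeal 3 (exMatrix k)) ≤ 3 := by
  let f : PolyR k 3 →ₐ[k] k := aeval fun _ => 0
  let P : PrimeSpectrum (PolyR k 3) := ⟨RingHom.ker f, RingHom.ker_isPrime f⟩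
  have hP : minorsIdeal 3 (exMatrix k) ≤ P.asIdeal := by
    refine Ideal.span_le.mpr ?_
    rintro _ ⟨r, c, rfl⟩
    have hφ : (exMatrix k).map f = 0 := by
      ext i j
      fin_cases i <;> fin_cases j <;> simp [exMatrix, f]
    change f _ = 0
    rw [AlgHom.map_det, AlgHom.mapMatrix_apply, ← Matrix.submatrix_map, hφ]
    simp
  refine (iInf₂_le P hP).trans ?_
  have h := Order.height_le_krullDim P
  rw [← ringKrullDim, MvPolynomial.ringKrullDim_of_isNoetherianRing,
    ringKrullDim_eq_zero_of_field] at h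
  exact WithBot.coe_le_coe.mp (by simpa using h)

/-- For the explicit `5 × 4` matrix `Φ` above: `x₁⁴` and
`x₂⁴ - 3x₁x₂²x₃ + x₁²x₃²` lie in the ideal `I₄(Φ)` of `4 × 4` minors; moreover
`ht(I₄(Φ)) ≥ 2` and `ht(I₃(Φ)) = 3`. -/
theorem stmt16 (k : Type) [Field k] :
    (X 0 ^ 4 : PolyR k 3) ∈ minorsIdeal 4 (exMatrix k) ∧
    (X 1 ^ 4 - 3 * X 0 * X 1 ^ 2 * X 2 + X 0 ^ 2 * X 2 ^ 2 : PolyR k 3) ∈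
      minorsIdeal 4 (exMatrix k) ∧
    (2 : ℕ∞) ≤ idealHeight (minorsIdeal 4 (exMatrix k)) ∧
    idealHeight (minorsIdeal 3 (exMatrix k)) = 3 := by
  refine ⟨X_zero_pow_mem_minorsIdeal_four k, tridiagonal_minor_mem_minorsIdeal_four k,
    le_iInf₂ fun P hP => ?_,
    le_antisymm (idealHeight_minorsIdeal_three_le k) (le_iInf₂ fun P hP => ?_)⟩
  · have h0 : X 0 ∈ P.asIdeal :=
      P.isPrime.mem_of_pow_mem 4 (hP (X_zero_pow_mem_minorsIdeal_four k))
    have h1 : X 1 ∈ P.asIdeal := by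
      refine P.isPrime.mem_of_pow_mem 4 ?_
      convert P.asIdeal.add_mem (hP (tridiagonal_minor_mem_minorsIdeal_four k))
        (P.asIdeal.mul_mem_right (3 * X 1 ^ 2 * X 2 - X 0 * X 2 ^ 2) h0) using 1
      ring
    exact card_le_height_of_X_mem {0, 1} P (by simp [h0, h1])
  · exact card_le_height_of_X_mem Finset.univ P fun i _ => X_mem_of_minorsIdeal_three_le hP i
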